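/- Q is stable under the action of W: for every τ ∈ W and every α ∈ Q, the element τ·α also lies in Q. -/

import Mathlib

/-- An element `χ` of `A` is *admissible* if it is not fixed by any nontrivial
element of `W`. -/
def AdmissibleElt (W : Type*) {A : Type*} [Group W] [CommGroup A]
    [MulDistribMulAction W A] (χ : A) : Prop :=
  ∀ w : W, w • χ = χ → w = 1

/-- The set `Q` of `α ∈ A` such that for every admissible `χ ∈ A` there is
`w ∈ W` with `α = χ · (w • χ)⁻¹`. -/
def QSet (W A : Type*) [Group W] [CommGroup A] [MulDistribMulAction W A] : Set A :=
  {α | ∀ χ : A, AdmissibleElt W χ → ∃ w : W, α = χ * (w • χ)⁻¹}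


/-- The action of `W` permutes the admissible elements. -/
theorem AdmissibleElt.smul {W A : Type*} [Group W] [CommGroup A] [MulDistribMulAction W A]
    {χ : A} (hχ : AdmissibleElt W χ) (τ : W) : AdmissibleElt W (τ • χ) := fun w hw =>
  conj_eq_one_iff.mp <| hχ (τ⁻¹ * w * τ⁻¹⁻¹) <| by
    rw [inv_inv, mul_smul, mul_smul, hw, inv_smul_smul]

/-- `Q` is stable under the action of `W`: for every `τ ∈ W` and `α ∈ Q`,
the element `τ • α` also lies in `Q`. -/
theorem QSet_stable_under_W (W A : Type*) [Group W] [Finite W] [CommGroup A]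
    [Finite A] [MulDistribMulAction W A] :
    ∀ τ : W, ∀ α ∈ QSet W A, τ • α ∈ QSet W A := by
  intro τ α hα χ hχ
  obtain ⟨w, rfl⟩ := hα (τ⁻¹ • χ) (hχ.smul τ⁻¹)
  exact ⟨τ * w * τ⁻¹, by simp only [smul_mul', smul_inv', smul_inv_smul, mul_smul]⟩
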